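/- Let R be a Noetherian local ring, I an ideal, and M a finitely generated R-module of dimension at most 3. Then for every finitely generated R-module N with Supp_R N ⊆ V(I), the set of associated primes Ass_R Ext^i_R(N, H^j_I(M)) is finite for all i, j ≥ 0. In particular, H^j_I(M) has finitely many associated primes for every j. -/

import Mathlib

open CategoryTheory

noncomputable section

universe u

/-- The Krull dimension of a module: `dim R/ann(M)`. -/
def moduleDim (R : Type u) [CommRing R] (M : Type*) [AddCommGroup M] [Module R M] :
    WithBot (WithTop ℕ) :=
  ringKrullDim (R ⧸ Module.annihilator R M)

/-- The depth of `M` with respect to an ideal `J`: the supremum of the lengths of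
`M`-regular sequences consisting of elements of `J`. -/
def moduleDepth (R : Type u) [CommRing R] (J : Ideal R) (M : Type*) [AddCommGroup M]
    [Module R M] : ℕ∞ :=
  sSup {n : ℕ∞ | ∃ rs : List R, (rs.length : ℕ∞) = n ∧ (∀ r ∈ rs, r ∈ J) ∧
    RingTheory.Sequence.IsRegular M rs}

/-- Serre's condition `S_ℓ` : for every prime `p` in the support of `M`,
`depth M_p ≥ min (ℓ, dim M_p)`. -/
def SerreCondition (R : Type u) [CommRing R] (ℓ : ℕ) (M : Type u) [AddCommGroup M]
    [Module R M] : Prop :=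
  ∀ p ∈ Module.support R M,
    min ((ℓ : ℕ∞) : WithBot ℕ∞)
        (moduleDim (Localization.AtPrime p.asIdeal) (LocalizedModule p.asIdeal.primeCompl M)) ≤
      ((moduleDepth (Localization.AtPrime p.asIdeal)
          (IsLocalRing.maximalIdeal (Localization.AtPrime p.asIdeal))
          (LocalizedModule p.asIdeal.primeCompl M) : ℕ∞) : WithBot ℕ∞)

/-- A module `N` over `S` is `J`-cofinite if its support is contained in `V(J)` and all the
modules `Ext^i_S(S/J, N)` are finitely generated. -/
def IsCofinite (S : Type u) [CommRing S] (J : Ideal S) (N : ModuleCat.{u} S) : Prop :=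
  Module.support S N ⊆ PrimeSpectrum.zeroLocus (J : Set S) ∧
  ∀ i : ℕ, Module.Finite S
    (((Ext S (ModuleCat.{u} S) i).obj (Opposite.op (ModuleCat.of S (S ⧸ J)))).obj N)

/-- A ring is catenary if any two saturated chains of primes with the same endpoints have
the same length. -/
def IsCatenaryRing (R : Type u) [CommRing R] : Prop :=
  ∀ c₁ c₂ : LTSeries (PrimeSpectrum R),
    c₁.head = c₂.head → c₁.last = c₂.last →
    (∀ i : Fin c₁.length, c₁.toFun i.castSucc ⋖ c₁.toFun i.succ) →
    (∀ i : Fin c₂.length, c₂.toFun i.castSucc ⋖ c₂.toFun i.succ) →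
    c₁.length = c₂.length

/-- A module is indecomposable if it is nonzero and is not the internal direct sum of two
nonzero submodules. -/
def ModuleIndecomposable (R : Type u) [CommRing R] (M : Type*) [AddCommGroup M]
    [Module R M] : Prop :=
  Nontrivial M ∧ ∀ N₁ N₂ : Submodule R M, IsCompl N₁ N₂ → N₁ = ⊥ ∨ N₂ = ⊥

/-- A module is equidimensional if `dim R/P = dim M` for every minimal prime `P`
of its support (equivalently, of its annihilator). -/
def Equidimensional (R : Type u) [CommRing R] (M : Type*) [AddCommGroup M]
    [Module R M] : Prop :=
  ∀ P ∈ (Module.annihilator R M).minimalPrimes, ringKrullDim (R ⧸ P) = moduleDim R M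

/-- A local ring is Cohen-Macaulay if its depth equals its Krull dimension. -/
def IsCMLocalRing (S : Type u) [CommRing S] [IsLocalRing S] : Prop :=
  ((moduleDepth S (IsLocalRing.maximalIdeal S) S : ℕ∞) : WithBot ℕ∞) = ringKrullDim S

/-- A ring is Cohen-Macaulay if all its localizations at primes are Cohen-Macaulay local
rings. -/
def IsCMRing (S : Type u) [CommRing S] : Prop :=
  ∀ p : PrimeSpectrum S, IsCMLocalRing (Localization.AtPrime p.asIdeal)

section CochainHomology

variable {R : Type u} [CommRing R] {K L : CochainComplex (ModuleCat.{u} R) ℕ}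

/-- A cocycle, viewed in the categorical object of cycles. -/
def cocycleLift (K : CochainComplex (ModuleCat.{u} R) ℕ) (n : ℕ) :
    LinearMap.ker (K.d n (n + 1)).hom →ₗ[R] K.cycles n :=
  (K.liftCycles (ModuleCat.ofHom (LinearMap.ker (K.d n (n + 1)).hom).subtype) (n + 1) (by simp)
    (ModuleCat.hom_ext (LinearMap.ext fun x ↦ x.2))).hom

/-- The class map from cocycles to cohomology. -/
def cocycleClass (K : CochainComplex (ModuleCat.{u} R) ℕ) (n : ℕ) :
    LinearMap.ker (K.d n (n + 1)).hom →ₗ[R] K.homology n :=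
  (K.homologyπ n).hom ∘ₗ cocycleLift K n

lemma iCycles_cocycleLift (n : ℕ) (x : LinearMap.ker (K.d n (n + 1)).hom) :
    (K.iCycles n).hom (cocycleLift K n x) = x := by
  rw [cocycleLift, ← LinearMap.comp_apply, ← ModuleCat.hom_comp, HomologicalComplex.liftCycles_i]
  rfl

lemma iCycles_injective (n : ℕ) : Function.Injective (K.iCycles n).hom :=
  (ModuleCat.mono_iff_injective _).1 inferInstance

lemma cocycleClass_surjective (n : ℕ) : Function.Surjective (cocycleClass K n) := by
  intro h
  obtain ⟨c, rfl⟩ := (ModuleCat.epi_iff_surjective (K.homologyπ n)).1 inferInstance h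
  refine ⟨⟨(K.iCycles n).hom c, ?_⟩, ?_⟩
  · rw [LinearMap.mem_ker, ← LinearMap.comp_apply, ← ModuleCat.hom_comp,
      HomologicalComplex.iCycles_d]
    rfl
  · exact congrArg (K.homologyπ n).hom (iCycles_injective n (iCycles_cocycleLift n _))

lemma cocycleClass_eq_zero_iff (n : ℕ) (x : LinearMap.ker (K.d n (n + 1)).hom) :
    cocycleClass K n x = 0 ↔
      ∃ y, (K.d ((ComplexShape.up ℕ).prev n) n).hom y = (x : K.X n) := by
  have hex : (ShortComplex.mk _ _ (K.toCycles_comp_homologyπ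
      ((ComplexShape.up ℕ).prev n) n)).Exact :=
    ShortComplex.exact_of_g_is_cokernel _ (K.homologyIsCokernel _ n rfl)
  rw [ShortComplex.ShortExact.moduleCat_exact_iff_function_exact] at hex
  have key (y) : (K.d ((ComplexShape.up ℕ).prev n) n).hom y =
      (K.iCycles n).hom ((K.toCycles ((ComplexShape.up ℕ).prev n) n).hom y) := by
    rw [← LinearMap.comp_apply, ← ModuleCat.hom_comp, K.toCycles_i]
  refine (hex _).trans ⟨?_, ?_⟩
  · rintro ⟨y, hy⟩
    exact ⟨y, (key y).trans ((congrArg _ hy).trans (iCycles_cocycleLift n x))⟩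
  · rintro ⟨y, hy⟩
    exact ⟨y, iCycles_injective n ((key y).symm.trans (hy.trans (iCycles_cocycleLift n x).symm))⟩

lemma cocycleClass_naturality (f : K ⟶ L) (n : ℕ) (x : LinearMap.ker (K.d n (n + 1)).hom)
    (y : LinearMap.ker (L.d n (n + 1)).hom) (h : (f.f n).hom (x : K.X n) = y) :
    (HomologicalComplex.homologyMap f n).hom (cocycleClass K n x) = cocycleClass L n y := by
  have h1 : (HomologicalComplex.cyclesMap f n).hom (cocycleLift K n x) = cocycleLift L n y := by
    refine iCycles_injective n ?_
    rw [iCycles_cocycleLift n y, ← h, ← iCycles_cocycleLift n x]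
    change (HomologicalComplex.cyclesMap f n ≫ L.iCycles n).hom _ = (K.iCycles n ≫ f.f n).hom _
    rw [HomologicalComplex.cyclesMap_i]
  rw [cocycleClass, cocycleClass, LinearMap.comp_apply, LinearMap.comp_apply, ← h1]
  change (K.homologyπ n ≫ HomologicalComplex.homologyMap f n).hom _ =
    (HomologicalComplex.cyclesMap f n ≫ L.homologyπ n).hom _
  rw [HomologicalComplex.homologyπ_naturality]

end CochainHomology

section ExtComparison

variable {R : Type u} [CommRing R]

open Opposite ProjectiveResolution

variable {N N' : ModuleCat.{u} R}

lemma comp_comp_inv_eq_of_comp_eq {C : Type*} [Category* C] {A A' H H' K K' : C} (e : A ⟶ A')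
    (a : A ⟶ H) (a' : A' ⟶ H') (b : H ⟶ H') (i : K ≅ H) (i' : K' ≅ H') (c : K ⟶ K')
    (h : e ≫ a' = a ≫ b) (h' : i.hom ≫ b = c ≫ i'.hom) :
    e ≫ a' ≫ i'.inv = (a ≫ i.inv) ≫ c := by
  rw [reassoc_of% h, Category.assoc]
  congr 1
  rw [Iso.comp_inv_eq, Category.assoc, ← h', Iso.inv_hom_id_assoc]

/-- The map on `Hom` complexes induced by a morphism of chain complexes. -/
def linearYonedaObjMap {P Q : ChainComplex (ModuleCat.{u} R) ℕ} (f : P ⟶ Q)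
    (Y : ModuleCat.{u} R) : Q.linearYonedaObj R Y ⟶ P.linearYonedaObj R Y :=
  (HomologicalComplex.unopFunctor _ _).map
    (((((linearYoneda R (ModuleCat.{u} R)).obj Y).rightOp.mapHomologicalComplex _).map f).op)

lemma isoExt_hom_naturality (P : ProjectiveResolution N) (P' : ProjectiveResolution N')
    (g : N' ⟶ N) (φ : Hom P' P g) (n : ℕ) (Y : ModuleCat.{u} R) :
    (((_root_.Ext R (ModuleCat.{u} R) n).map g.op).app Y) ≫ (P'.isoExt n Y).hom =
      (P.isoExt n Y).hom ≫
        HomologicalComplex.homologyMap (linearYonedaObjMap φ.hom Y) n := by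
  have h1 := congrArg Quiver.Hom.unop
    (ProjectiveResolution.isoLeftDerivedObj_inv_naturality g P' P φ.hom
      (by simpa using φ.hom_f_zero_comp_π_f_zero)
      ((linearYoneda R (ModuleCat.{u} R)).obj Y).rightOp n)
  have h2 := congrArg Quiver.Hom.unop
    (HomologicalComplex.homologyOp_hom_naturality (linearYonedaObjMap φ.hom Y) n)
  exact comp_comp_inv_eq_of_comp_eq _ _ _ _
    (HomologicalComplex.homologyUnop ((((linearYoneda R
      (ModuleCat.{u} R)).obj Y).rightOp.mapHomologicalComplex _).obj P.complex) n)
    (HomologicalComplex.homologyUnop ((((linearYoneda R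
      (ModuleCat.{u} R)).obj Y).rightOp.mapHomologicalComplex _).obj P'.complex) n) _ h1 h2

lemma extMk_eq_zero_iff_of_degree_zero (P : ProjectiveResolution N) {Y : ModuleCat.{u} R}
    (f : P.complex.X 0 ⟶ Y) (hf : P.complex.d 1 0 ≫ f = 0) :
    P.extMk f 1 rfl hf = 0 ↔ f = 0 := by
  refine ⟨fun h ↦ ?_, fun h ↦ by subst h; simp⟩
  have h' := congrArg P.extEquivCohomologyClass h
  rw [extEquivCohomologyClass_extMk, extEquivCohomologyClass_zero,
    CochainComplex.HomComplex.CohomologyClass.mk_eq_zero_iff,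
    CochainComplex.HomComplex.Cocycle.toSingleMk_mem_coboundaries_iff _ _ _ _ _ 1 (by lia)] at h'
  obtain ⟨g, hg⟩ := h'
  have hz : Limits.IsZero (P.cochainComplex.X 1) := P.cochainComplex.isZero_of_isStrictlyLE 0 1
  rw [hz.eq_of_src g 0, Limits.comp_zero] at hg
  exact (cancel_epi (P.cochainComplexXIso (-((0 : ℕ) : ℤ)) 0 rfl).hom).1
    (hg.symm.trans Limits.comp_zero.symm)

lemma extMk_eq_zero_iff_exists (P : ProjectiveResolution N) {Y : ModuleCat.{u} R} (n : ℕ)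
    (f : P.complex.X n ⟶ Y) (hf : P.complex.d (n + 1) n ≫ f = 0) :
    P.extMk f (n + 1) rfl hf = 0 ↔
      ∃ g : P.complex.X ((ComplexShape.up ℕ).prev n) ⟶ Y,
        P.complex.d n ((ComplexShape.up ℕ).prev n) ≫ g = f := by
  cases n with
  | zero =>
    rw [extMk_eq_zero_iff_of_degree_zero]
    refine ⟨fun h ↦ ⟨0, by simp [h]⟩, ?_⟩
    rintro ⟨g, rfl⟩
    rw [P.complex.shape, Limits.zero_comp]
    simp
  | succ p =>
    rw [CochainComplex.prev_nat_succ]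
    exact P.extMk_eq_zero_iff f _ rfl hf p rfl

lemma extMk_congr (P : ProjectiveResolution N) {Y : ModuleCat.{u} R} {n : ℕ}
    {f f' : P.complex.X n ⟶ Y} (hf : P.complex.d (n + 1) n ≫ f = 0)
    (hf' : P.complex.d (n + 1) n ≫ f' = 0) (h : f = f') :
    P.extMk f (n + 1) rfl hf = P.extMk f' (n + 1) rfl hf' := by
  subst h
  rfl

/-- The map from cocycles of a projective resolution to `Ext`. -/
def extMkLinear (P : ProjectiveResolution N) (Y : ModuleCat.{u} R) (n : ℕ) :
    LinearMap.ker ((P.complex.linearYonedaObj R Y).d n (n + 1)).hom →ₗ[R] Abelian.Ext N Y n where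
  toFun f := P.extMk (show P.complex.X n ⟶ Y from f.1) (n + 1) rfl f.2
  map_add' f g := (P.add_extMk _ _ _ _ _ _).symm
  map_smul' r f := by
    refine Eq.trans ?_ ((Abelian.Ext.smul_eq_comp_mk₀ _ r).trans
      (P.extMk_comp_mk₀ _ _ _ _ _)).symm
    exact extMk_congr P _ _ ((Linear.comp_smul _ _ _ _ _ _).trans
      (congrArg (r • ·) (Category.comp_id _))).symm

lemma extMkLinear_surjective (P : ProjectiveResolution N) (Y : ModuleCat.{u} R) (n : ℕ) :
    Function.Surjective (extMkLinear P Y n) := by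
  intro α
  obtain ⟨f, hf, rfl⟩ := P.extMk_surjective α (n + 1) rfl
  exact ⟨⟨f, hf⟩, rfl⟩

lemma ker_cocycleClass_eq_ker_extMkLinear (P : ProjectiveResolution N) (Y : ModuleCat.{u} R)
    (n : ℕ) : LinearMap.ker (cocycleClass (P.complex.linearYonedaObj R Y) n) =
      LinearMap.ker (extMkLinear P Y n) := by
  ext f
  rw [LinearMap.mem_ker, LinearMap.mem_ker, cocycleClass_eq_zero_iff]
  exact (extMk_eq_zero_iff_exists P n _ f.2).symm

/-- The linear equivalence between the two constructions of `Ext`, computed with a projective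
resolution. -/
def extEquivOfResolution (P : ProjectiveResolution N) (Y : ModuleCat.{u} R) (n : ℕ) :
    (((_root_.Ext R (ModuleCat.{u} R) n).obj (op N)).obj Y) ≃ₗ[R] Abelian.Ext N Y n :=
  (P.isoExt n Y).toLinearEquiv ≪≫ₗ
    ((cocycleClass _ n).quotKerEquivOfSurjective (cocycleClass_surjective n)).symm ≪≫ₗ
    Submodule.quotEquivOfEq _ _ (ker_cocycleClass_eq_ker_extMkLinear P Y n) ≪≫ₗ
    (extMkLinear P Y n).quotKerEquivOfSurjective (extMkLinear_surjective P Y n)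

lemma extEquivOfResolution_apply (P : ProjectiveResolution N) (Y : ModuleCat.{u} R) (n : ℕ)
    (z : ((_root_.Ext R (ModuleCat.{u} R) n).obj (op N)).obj Y)
    (x : LinearMap.ker ((P.complex.linearYonedaObj R Y).d n (n + 1)).hom)
    (h : (P.isoExt n Y).hom.hom z = cocycleClass _ n x) :
    extEquivOfResolution P Y n z = extMkLinear P Y n x := by
  have h' : ((cocycleClass _ n).quotKerEquivOfSurjective (cocycleClass_surjective n)).symm
      ((P.isoExt n Y).hom.hom z) = Submodule.Quotient.mk x := by
    rw [h, LinearEquiv.symm_apply_eq]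
    rfl
  exact (congrArg (fun t ↦ (extMkLinear P Y n).quotKerEquivOfSurjective
    (extMkLinear_surjective P Y n)
    (Submodule.quotEquivOfEq _ _ (ker_cocycleClass_eq_ker_extMkLinear P Y n) t)) h').trans
      (b := (extMkLinear P Y n).quotKerEquivOfSurjective (extMkLinear_surjective P Y n)
        (Submodule.quotEquivOfEq _ _ (ker_cocycleClass_eq_ker_extMkLinear P Y n)
          (Submodule.Quotient.mk x))) rfl

lemma extEquivOfResolution_naturality (P : ProjectiveResolution N) (P' : ProjectiveResolution N')
    (g : N' ⟶ N) (φ : Hom P' P g) (n : ℕ) (Y : ModuleCat.{u} R)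
    (z : ((_root_.Ext R (ModuleCat.{u} R) n).obj (op N)).obj Y) :
    extEquivOfResolution P' Y n ((((_root_.Ext R (ModuleCat.{u} R) n).map g.op).app Y).hom z) =
      (Abelian.Ext.mk₀ g).comp (extEquivOfResolution P Y n z) (zero_add n) := by
  obtain ⟨x, hx⟩ := cocycleClass_surjective (K := P.complex.linearYonedaObj R Y) n
    ((P.isoExt n Y).hom.hom z)
  have hf : P'.complex.d (n + 1) n ≫ φ.hom.f n ≫ (show P.complex.X n ⟶ Y from x.1) = 0 := by
    have := x.2
    change P.complex.d (n + 1) n ≫ (show P.complex.X n ⟶ Y from x.1) = 0 at this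
    rw [← φ.hom.comm_assoc, this, Limits.comp_zero]
  rw [extEquivOfResolution_apply P Y n z x hx.symm,
    extEquivOfResolution_apply P' Y n _ ⟨φ.hom.f n ≫ (show P.complex.X n ⟶ Y from x.1), hf⟩]
  · exact (mk₀_comp_extMk (show P.complex.X n ⟶ Y from x.1) (n + 1) rfl x.2 φ).symm
  · refine Eq.trans ?_ (cocycleClass_naturality (linearYonedaObjMap φ.hom Y) n x _ rfl)
    rw [hx]
    exact congrArg (fun t ↦ t.hom z) (isoExt_hom_naturality P P' g φ n Y)

/-- The linear equivalence between the two constructions of `Ext` for modules. -/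
def extEquiv (N Y : ModuleCat.{u} R) (n : ℕ) :
    (((_root_.Ext R (ModuleCat.{u} R) n).obj (op N)).obj Y) ≃ₗ[R] Abelian.Ext N Y n :=
  extEquivOfResolution (projectiveResolution N) Y n

lemma extEquiv_naturality (g : N' ⟶ N) (Y : ModuleCat.{u} R) (n : ℕ)
    (z : ((_root_.Ext R (ModuleCat.{u} R) n).obj (op N)).obj Y) :
    extEquiv N' Y n ((((_root_.Ext R (ModuleCat.{u} R) n).map g.op).app Y).hom z) =
      (Abelian.Ext.mk₀ g).comp (extEquiv N Y n z) (zero_add n) :=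
  extEquivOfResolution_naturality _ _ g
    ⟨lift g _ _, HomologicalComplex.congr_hom (lift_commutes g _ _) 0⟩ n Y z

end ExtComparison

section PowerQuotients

variable {R : Type u} [CommRing R] (I : Ideal R)

/-- The module `R ⧸ I ^ n`. -/
abbrev powQuot (n : ℕ) : ModuleCat.{u} R := ModuleCat.of R (R ⧸ I ^ n)

/-- The projection `R ⧸ I ^ m ⟶ R ⧸ I ^ n` for `n ≤ m`. -/
def powQuotMap {n m : ℕ} (h : n ≤ m) : powQuot I m ⟶ powQuot I n :=
  ModuleCat.ofHom (Submodule.mapQ _ _ LinearMap.id (Ideal.pow_le_pow_right h))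

/-- The transition maps of the direct system `Ext (R ⧸ I ^ n) X j`. -/
def extRes (X : ModuleCat.{u} R) (j : ℕ) {n m : ℕ} (h : n ≤ m) :
    Abelian.Ext (powQuot I n) X j →ₗ[R] Abelian.Ext (powQuot I m) X j where
  toFun z := (Abelian.Ext.mk₀ (powQuotMap I h)).comp z (zero_add j)
  map_add' _ _ := Abelian.Ext.comp_add _ _ _ _
  map_smul' _ _ := Abelian.Ext.comp_smul _ _ _ _

lemma powQuotMap_comp {n m k : ℕ} (h : n ≤ m) (h' : m ≤ k) :
    powQuotMap I h' ≫ powQuotMap I h = powQuotMap I (h.trans h') := by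
  ext
  rfl

lemma extRes_extRes (X : ModuleCat.{u} R) (j : ℕ) {n m k : ℕ} (h : n ≤ m) (h' : m ≤ k)
    (z : Abelian.Ext (powQuot I n) X j) :
    extRes I X j h' (extRes I X j h z) = extRes I X j (h.trans h') z := by
  simp only [extRes, LinearMap.coe_mk, AddHom.coe_mk]
  rw [← Abelian.Ext.comp_assoc _ _ _ (add_zero 0) (zero_add j) (by simp),
    Abelian.Ext.mk₀_comp_mk₀, powQuotMap_comp]

/-- The canonical maps to local cohomology. -/
lemma exists_toLocalCohomology (X : ModuleCat.{u} R) (j : ℕ) :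
    ∃ φ : ∀ n, Abelian.Ext (powQuot I n) X j →ₗ[R] ↥((localCohomology I j).obj X),
      (∀ n m (h : n ≤ m) z, φ m (extRes I X j h z) = φ n z) ∧
      (∀ y, ∃ n z, φ n z = y) ∧
      (∀ n z, φ n z = 0 → ∃ m, ∃ h : n ≤ m, extRes I X j h z = 0) := by
  let D := localCohomology.diagram (localCohomology.idealPowersDiagram I) j
  have : Limits.HasColimit D := localCohomology.hasColimitDiagram.{u, 0} _ j
  let ev := (evaluation (ModuleCat.{u} R) (ModuleCat.{u} R)).obj X
  let c := ev.mapCocone (Limits.colimit.cocone D)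
  have hc : Limits.IsColimit c := Limits.isColimitOfPreserves ev (Limits.colimit.isColimit D)
  let F := D ⋙ ev
  have hF (n m : ℕ) (w : Opposite.op (Opposite.op n) ⟶ Opposite.op (Opposite.op m)) (h : n ≤ m)
      (z : F.obj (Opposite.op (Opposite.op n))) :
      extEquiv (powQuot I m) X j ((F.map w).hom z) =
        extRes I X j h (extEquiv (powQuot I n) X j z) :=
    extEquiv_naturality (powQuotMap I h) X j z
  have : Limits.PreservesColimit F (forget (ModuleCat.{u} R)) := by
    have := Limits.preservesFilteredColimitsOfSize_shrink.{0, u, 0, u} (forget (ModuleCat.{u} R))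
    have : IsFiltered ℕᵒᵖᵒᵖ := inferInstance
    infer_instance
  refine ⟨fun n ↦ (c.ι.app (Opposite.op (Opposite.op n))).hom ∘ₗ
    (extEquiv (powQuot I n) X j).symm.toLinearMap, fun n m h z ↦ ?_, fun y ↦ ?_, fun n z hz ↦ ?_⟩
  · have hw := c.w (homOfLE h).op.op
    have : (extEquiv (powQuot I m) X j).symm (extRes I X j h z) =
        (F.map (homOfLE h).op.op).hom ((extEquiv (powQuot I n) X j).symm z) := by
      refine (LinearEquiv.symm_apply_eq _).2 ?_
      exact ((hF n m _ h _).trans (congrArg _ (LinearEquiv.apply_symm_apply _ z))).symm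
    exact (congrArg _ this).trans
      (congrArg (fun t ↦ t.hom ((extEquiv (powQuot I n) X j).symm z)) hw)
  · obtain ⟨n, z, hz⟩ := Limits.Concrete.isColimit_exists_rep F hc y
    refine ⟨n.unop.unop, extEquiv (powQuot I n.unop.unop) X j z, ?_⟩
    exact (congrArg _ (LinearEquiv.symm_apply_apply _ z)).trans hz
  · let z' : F.obj (Opposite.op (Opposite.op n)) := (extEquiv (powQuot I n) X j).symm z
    have hz' : c.ι.app (Opposite.op (Opposite.op n)) z' =
        c.ι.app (Opposite.op (Opposite.op n)) (0 : F.obj (Opposite.op (Opposite.op n))) :=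
      hz.trans (map_zero (c.ι.app (Opposite.op (Opposite.op n))).hom).symm
    obtain ⟨k, f, g, h⟩ := Limits.Concrete.isColimit_exists_of_rep_eq F hc z' 0 hz'
    have hk : n ≤ k.unop.unop := leOfHom f.unop.unop
    refine ⟨k.unop.unop, hk, ?_⟩
    have h1 := hF n k.unop.unop f hk z'
    have h2 : extEquiv (powQuot I n) X j z' = z := LinearEquiv.apply_symm_apply _ z
    rw [h2] at h1
    rw [← h1]
    exact (congrArg _ (h.trans (map_zero (F.map g).hom))).trans
      (map_zero (extEquiv (powQuot I k.unop.unop) X j))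

end PowerQuotients

section LocalCohomologyTorsion

variable {R : Type u} [CommRing R] (I : Ideal R) (S : Submonoid R)

/-- The condition that every element of `H^j_I(X)` is killed by an element of `S`, phrased through
the direct system of the `Ext (R ⧸ I ^ n) X j`. -/
def IsLocCohTorsion (j : ℕ) (X : ModuleCat.{u} R) : Prop :=
  ∀ n (z : Abelian.Ext (powQuot I n) X j), ∃ m, ∃ h : n ≤ m, ∃ s ∈ S, s • extRes I X j h z = 0

variable {I S}

lemma extRes_comp {X Y : ModuleCat.{u} R} {i j k n m : ℕ} (h : n ≤ m)
    (z : Abelian.Ext (powQuot I n) X i) (β : Abelian.Ext X Y j) (hk : i + j = k) :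
    (extRes I X i h z).comp β hk = extRes I Y k h (z.comp β hk) :=
  Abelian.Ext.comp_assoc _ _ _ (zero_add i) hk (by lia)

variable {C : ShortComplex (ModuleCat.{u} R)}

lemma IsLocCohTorsion.of_X₁_X₃ (hC : C.ShortExact) {j : ℕ} (h₁ : IsLocCohTorsion I S j C.X₁)
    (h₃ : IsLocCohTorsion I S j C.X₃) : IsLocCohTorsion I S j C.X₂ := by
  intro n z
  obtain ⟨m, hm, s, hs, e⟩ := h₃ n (z.comp (Abelian.Ext.mk₀ C.g) (add_zero j))
  rw [← extRes_comp, ← Abelian.Ext.smul_comp] at e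
  obtain ⟨w, hw⟩ := Abelian.Ext.covariant_sequence_exact₂ _ hC _ e
  obtain ⟨k, hk, t, ht, e'⟩ := h₁ m w
  refine ⟨k, hm.trans hk, t * s, S.mul_mem ht hs, ?_⟩
  rw [← extRes_extRes I _ j hm hk, mul_smul, ← map_smul _ s, ← hw, ← extRes_comp,
    ← Abelian.Ext.smul_comp, e', Abelian.Ext.zero_comp]

lemma IsLocCohTorsion.of_X₂_X₃ (hC : C.ShortExact) {j : ℕ} (h₂ : IsLocCohTorsion I S (j + 1) C.X₂)
    (h₃ : IsLocCohTorsion I S j C.X₃) : IsLocCohTorsion I S (j + 1) C.X₁ := by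
  intro n z
  obtain ⟨m, hm, s, hs, e⟩ := h₂ n (z.comp (Abelian.Ext.mk₀ C.f) (add_zero _))
  rw [← extRes_comp, ← Abelian.Ext.smul_comp] at e
  obtain ⟨w, hw⟩ := Abelian.Ext.covariant_sequence_exact₁ _ hC _ e rfl
  obtain ⟨k, hk, t, ht, e'⟩ := h₃ m w
  refine ⟨k, hm.trans hk, t * s, S.mul_mem ht hs, ?_⟩
  rw [← extRes_extRes I _ _ hm hk, mul_smul, ← map_smul _ s, ← hw, ← extRes_comp,
    ← Abelian.Ext.smul_comp, e', Abelian.Ext.zero_comp]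

lemma IsLocCohTorsion.of_X₂_X₁ (hC : C.ShortExact) {j : ℕ} (h₂ : IsLocCohTorsion I S j C.X₂)
    (h₁ : IsLocCohTorsion I S (j + 1) C.X₁) : IsLocCohTorsion I S j C.X₃ := by
  intro n z
  obtain ⟨m, hm, s, hs, e⟩ := h₁ n (z.comp hC.extClass rfl)
  rw [← extRes_comp, ← Abelian.Ext.smul_comp] at e
  obtain ⟨w, hw⟩ := Abelian.Ext.covariant_sequence_exact₃ _ hC _ rfl e
  obtain ⟨k, hk, t, ht, e'⟩ := h₂ m w
  refine ⟨k, hm.trans hk, t * s, S.mul_mem ht hs, ?_⟩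
  rw [← extRes_extRes I _ _ hm hk, mul_smul, ← map_smul _ s, ← hw, ← extRes_comp,
    ← Abelian.Ext.smul_comp, e', Abelian.Ext.zero_comp]

lemma IsLocCohTorsion.of_mono {X Y : ModuleCat.{u} R} (f : X ⟶ Y) [Mono f]
    (h : IsLocCohTorsion I S 0 Y) : IsLocCohTorsion I S 0 X := by
  intro n z
  obtain ⟨m, hm, s, hs, e⟩ := h n (z.comp (Abelian.Ext.mk₀ f) (add_zero _))
  rw [← extRes_comp, ← Abelian.Ext.smul_comp] at e
  exact ⟨m, hm, s, hs, Abelian.Ext.postcomp_mk₀_injective_of_mono _ f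
    (e.trans (map_zero _).symm)⟩

lemma isLocCohTorsion_of_injective {j : ℕ} (X : ModuleCat.{u} R) [Injective X] :
    IsLocCohTorsion I S (j + 1) X := fun n z ↦
  ⟨n, le_rfl, 1, S.one_mem, by rw [Abelian.Ext.eq_zero_of_injective z, map_zero, smul_zero]⟩

lemma ext_smul_eq_zero_of_left {X Y : ModuleCat.{u} R} {j : ℕ} (r : R)
    (h : ∀ x : X, r • x = 0) (z : Abelian.Ext X Y j) : r • z = 0 := by
  have h0 : r • 𝟙 X = 0 := by
    ext x
    exact h x
  rw [← Abelian.Ext.mk₀_id_comp z, ← Abelian.Ext.smul_comp, ← Abelian.Ext.mk₀_smul, h0,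
    Abelian.Ext.mk₀_zero, Abelian.Ext.zero_comp]

lemma ext_smul_eq_zero_of_right {X Y : ModuleCat.{u} R} {j : ℕ} (r : R)
    (h : ∀ x : Y, r • x = 0) (z : Abelian.Ext X Y j) : r • z = 0 := by
  have h0 : r • 𝟙 Y = 0 := by
    ext x
    exact h x
  rw [Abelian.Ext.smul_eq_comp_mk₀, h0, Abelian.Ext.mk₀_zero, Abelian.Ext.comp_zero]

lemma pow_smul_powQuot_eq_zero {n : ℕ} {s : R} (hs : s ∈ I ^ n) (x : powQuot I n) :
    s • x = 0 := by
  obtain ⟨x, rfl⟩ := Ideal.Quotient.mk_surjective x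
  exact Ideal.Quotient.eq_zero_iff_mem.2 (Ideal.mul_mem_right x _ hs)

lemma isLocCohTorsion_of_mem {j : ℕ} (X : ModuleCat.{u} R) {s : R} (hs : s ∈ S) (hsI : s ∈ I) :
    IsLocCohTorsion I S j X := fun n _ ↦
  ⟨n, le_rfl, s ^ n, S.pow_mem hs n, ext_smul_eq_zero_of_left _
    (pow_smul_powQuot_eq_zero (Ideal.pow_mem_pow hsI n)) _⟩

end LocalCohomologyTorsion

section PowTorsion

variable {R : Type u} [CommRing R] (I : Ideal R) (X : Type*) [AddCommGroup X] [Module R X]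

/-- The submodule of elements killed by some power of `I`. -/
def powTorsion : Submodule R X where
  carrier := {x | ∃ n, ∀ r ∈ I ^ n, r • x = 0}
  add_mem' := by
    rintro x y ⟨n, hn⟩ ⟨m, hm⟩
    refine ⟨n + m, fun r hr ↦ ?_⟩
    rw [smul_add, hn r (Ideal.pow_le_pow_right (by lia) hr),
      hm r (Ideal.pow_le_pow_right (by lia) hr), add_zero]
  zero_mem' := ⟨0, fun r _ ↦ smul_zero r⟩
  smul_mem' := by
    rintro c x ⟨n, hn⟩
    exact ⟨n, fun r hr ↦ by rw [smul_comm, hn r hr, smul_zero]⟩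

variable {I X}

lemma map_mem_powTorsion {Y : Type*} [AddCommGroup Y] [Module R Y] (f : X →ₗ[R] Y) {x : X}
    (hx : x ∈ powTorsion I X) : f x ∈ powTorsion I Y := by
  obtain ⟨n, hn⟩ := hx
  exact ⟨n, fun r hr ↦ by rw [← map_smul, hn r hr, map_zero]⟩

lemma mem_powTorsion_of_injective {Y : Type*} [AddCommGroup Y] [Module R Y] {f : X →ₗ[R] Y}
    (hf : Function.Injective f) {x : X} (hx : f x ∈ powTorsion I Y) : x ∈ powTorsion I X := by
  obtain ⟨n, hn⟩ := hx
  exact ⟨n, fun r hr ↦ hf (by rw [map_smul, hn r hr, map_zero])⟩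

lemma exists_pow_smul_eq_zero_of_fg (N : Submodule R X) (hN : N.FG) (h : N ≤ powTorsion I X) :
    ∃ k, ∀ r ∈ I ^ k, ∀ x ∈ N, r • x = 0 := by
  induction N, hN using Submodule.fg_induction with
  | singleton x =>
    obtain ⟨n, hn⟩ := h (Submodule.mem_span_singleton_self x)
    refine ⟨n, fun r hr y hy ↦ ?_⟩
    obtain ⟨a, rfl⟩ := Submodule.mem_span_singleton.1 hy
    rw [smul_comm, hn r hr, smul_zero]
  | sup N₁ N₂ _ _ h₁ h₂ =>
    obtain ⟨n, hn⟩ := h₁ (le_sup_left.trans h)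
    obtain ⟨m, hm⟩ := h₂ (le_sup_right.trans h)
    refine ⟨n + m, fun r hr y hy ↦ ?_⟩
    obtain ⟨a, ha, b, hb, rfl⟩ := Submodule.mem_sup.1 hy
    rw [smul_add, hn r (Ideal.pow_le_pow_right (by lia) hr) a ha,
      hm r (Ideal.pow_le_pow_right (by lia) hr) b hb, add_zero]

lemma powTorsion_powTorsion : powTorsion I (powTorsion I X) = ⊤ :=
  eq_top_iff.2 fun x _ ↦ mem_powTorsion_of_injective
    (f := (powTorsion I X).subtype) Subtype.val_injective x.2

lemma powTorsion_quotient [IsNoetherianRing R] : powTorsion I (X ⧸ powTorsion I X) = ⊥ := by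
  rw [eq_bot_iff]
  intro y hy
  obtain ⟨x, rfl⟩ := Submodule.Quotient.mk_surjective _ y
  obtain ⟨n, hn⟩ := hy
  obtain ⟨k, hk⟩ := exists_pow_smul_eq_zero_of_fg (I := I) (I ^ n • Submodule.span R {x})
    (Submodule.FG.smul (IsNoetherian.noetherian (I ^ n)) (Submodule.fg_span_singleton x)) (by
      rw [Submodule.smul_le]
      intro r hr z hz
      obtain ⟨a, rfl⟩ := Submodule.mem_span_singleton.1 hz
      rw [smul_comm]
      exact Submodule.smul_mem _ _
        ((Submodule.Quotient.mk_eq_zero _).1 ((Submodule.Quotient.mk_smul _ _ _).trans (hn r hr))))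
  rw [Submodule.mem_bot, Submodule.Quotient.mk_eq_zero]
  refine ⟨k + n, fun r hr ↦ ?_⟩
  rw [pow_add] at hr
  induction hr using Submodule.mul_induction_on' with
  | mem_mul_mem a ha b hb =>
    rw [mul_smul]
    exact hk a ha _ (Submodule.smul_mem_smul hb (Submodule.mem_span_singleton_self x))
  | add a _ b _ ha hb => rw [add_smul, ha, hb, add_zero]

end PowTorsion

section InjectivePowTorsion

variable {R : Type u} [CommRing R] [IsNoetherianRing R] (I : Ideal R)

lemma injective_powTorsion (E : Type u) [AddCommGroup E] [Module R E] [Module.Injective R E] :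
    Module.Injective R (powTorsion I E) := by
  refine Module.Baer.injective fun J f ↦ ?_
  obtain ⟨k, hk⟩ := exists_pow_smul_eq_zero_of_fg (I := I) (LinearMap.range f)
    (by
      rw [LinearMap.range_eq_map]
      exact (IsNoetherian.noetherian (⊤ : Submodule R J)).map f) (by
      rw [powTorsion_powTorsion]
      exact le_top)
  obtain ⟨c, hc⟩ := I.exists_pow_inf_eq_pow_smul J
  let J' : Submodule R J := Submodule.comap J.subtype (I ^ (k + c) : Submodule R R)
  have hJ' : J' ≤ LinearMap.ker ((powTorsion I E).subtype ∘ₗ f) := by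
    intro x hx
    have h1 : (x : R) ∈ I ^ (k + c) • (⊤ : Ideal R) ⊓ J := ⟨by simpa [J'] using hx, x.2⟩
    rw [hc (k + c) (by lia), Nat.add_sub_cancel] at h1
    have h2 : I ^ k • (I ^ c • (⊤ : Ideal R) ⊓ J) ≤ (LinearMap.ker f).map J.subtype := by
      rw [Submodule.smul_le]
      intro r hr y hy
      refine ⟨r • ⟨y, hy.2⟩, ?_, rfl⟩
      rw [SetLike.mem_coe, LinearMap.mem_ker, map_smul]
      exact hk r hr _ ⟨_, rfl⟩
    obtain ⟨y, hy, hxy⟩ := h2 h1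
    obtain rfl : y = x := Subtype.ext hxy
    rw [LinearMap.mem_ker, LinearMap.comp_apply, LinearMap.mem_ker.1 hy, map_zero]
  obtain ⟨g, hg⟩ := Module.Injective.out (R := R) (Q := E)
    (Submodule.mapQ J' (I ^ (k + c)) J.subtype le_rfl)
    (by
      rw [← LinearMap.ker_eq_bot, Submodule.ker_mapQ]
      exact Submodule.mkQ_map_self J')
    (J'.liftQ ((powTorsion I E).subtype ∘ₗ f) hJ')
  refine ⟨(g ∘ₗ (I ^ (k + c)).mkQ).codRestrict _ fun x ↦ ⟨k + c, fun r hr ↦ ?_⟩, fun x hx ↦ ?_⟩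
  · rw [LinearMap.comp_apply, ← map_smul, ← map_smul, Submodule.mkQ_apply,
      smul_eq_mul,
      (Submodule.Quotient.mk_eq_zero _).2 (Ideal.mul_mem_right _ _ hr), map_zero]
  · exact Subtype.ext (hg (Submodule.Quotient.mk ⟨x, hx⟩))

lemma exists_injective_powTorsion_eq_bot (Y : Type u) [AddCommGroup Y] [Module R Y]
    (hY : powTorsion I Y = ⊥) :
    ∃ (E : ModuleCat.{u} R) (f : ModuleCat.of R Y ⟶ E), Injective E ∧ Mono f ∧
      powTorsion I E = ⊥ := by
  let E := Injective.under (ModuleCat.of R Y)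
  have hE' : Injective (ModuleCat.of R E) :=
    inferInstanceAs (Injective (Injective.under (ModuleCat.of R Y)))
  have hE : Module.Injective R E := Module.injective_module_of_injective_object _ _
  let ι : Y →ₗ[R] E := (Injective.ι (ModuleCat.of R Y)).hom
  have hι : Function.Injective ι := (ModuleCat.mono_iff_injective _).1 (Injective.ι_mono _)
  have hG := injective_powTorsion I E
  obtain ⟨r, hr⟩ := hG.out (powTorsion I E).subtype Subtype.val_injective LinearMap.id
  have hr' (x : E) (hx : x ∈ powTorsion I E) : (r x : E) = x :=
    congrArg Subtype.val (hr ⟨x, hx⟩)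
  let s : E →ₗ[R] LinearMap.ker r :=
    (LinearMap.id - (powTorsion I E).subtype ∘ₗ r).codRestrict _ fun x ↦ by
      rw [LinearMap.mem_ker, LinearMap.sub_apply, map_sub]
      exact sub_eq_zero.2 (hr (r x)).symm
  have hs (x : E) (hx : r x = 0) : s x = ⟨x, hx⟩ := Subtype.ext (by
    change x - (r x : E) = x
    rw [hx]
    simp)
  have hinj : Module.Injective R (LinearMap.ker r) := by
    refine ⟨fun A B _ _ _ _ f hf g ↦ ?_⟩
    obtain ⟨h, hh⟩ := hE.out f hf ((LinearMap.ker r).subtype ∘ₗ g)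
    exact ⟨s ∘ₗ h, fun x ↦ by
      rw [LinearMap.comp_apply, hh]
      exact hs _ (g x).2⟩
  refine ⟨ModuleCat.of R (LinearMap.ker r), ModuleCat.ofHom (s ∘ₗ ι),
    Module.injective_object_of_injective_module _ _, (ModuleCat.mono_iff_injective _).2 ?_, ?_⟩
  · refine (injective_iff_map_eq_zero (s ∘ₗ ι)).2 fun y hy ↦ ?_
    have h1 : ι y = (r (ι y) : E) := sub_eq_zero.1 (congrArg Subtype.val hy)
    have h2 : y ∈ powTorsion I Y :=
      mem_powTorsion_of_injective hι (h1 ▸ (r (ι y)).2)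
    rwa [hY, Submodule.mem_bot] at h2
  · rw [eq_bot_iff]
    intro x hx
    have h1 : (x : E) ∈ powTorsion I E := map_mem_powTorsion (LinearMap.ker r).subtype hx
    have h2 := hr' x h1
    rw [LinearMap.mem_ker.1 x.2] at h2
    exact Subtype.ext h2.symm

end InjectivePowTorsion

section ShortExactSequences

variable {R : Type u} [CommRing R]

/-- The short complex `0 → N → X → X ⧸ N → 0`. -/
abbrev quotComplex {X : Type u} [AddCommGroup X] [Module R X] (N : Submodule R X) :
    ShortComplex (ModuleCat.{u} R) :=
  ModuleCat.shortComplexOfCompEqZero N.subtype N.mkQ (by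
    ext x
    simp)

lemma quotComplex_shortExact {X : Type u} [AddCommGroup X] [Module R X] (N : Submodule R X) :
    (quotComplex N).ShortExact :=
  ModuleCat.shortComplex_shortExact _ (LinearMap.exact_subtype_mkQ N) Subtype.val_injective
    N.mkQ_surjective

/-- The short complex `0 → X → Y → cokernel f → 0`. -/
abbrev cokerComplex {X Y : ModuleCat.{u} R} (f : X ⟶ Y) : ShortComplex (ModuleCat.{u} R) :=
  ShortComplex.mk f (Limits.cokernel.π f) (Limits.cokernel.condition f)

lemma cokerComplex_shortExact {X Y : ModuleCat.{u} R} (f : X ⟶ Y) [Mono f] :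
    (cokerComplex f).ShortExact where
  exact := ShortComplex.exact_cokernel f

end ShortExactSequences

section TorsionVanishing

variable {R : Type u} [CommRing R] {I : Ideal R}

/-- The morphism `R ⧸ I ^ n ⟶ X` determined by an element killed by `I ^ n`. -/
def powQuotLift {X : ModuleCat.{u} R} {n : ℕ} (x : X) (hx : ∀ r ∈ I ^ n, r • x = 0) :
    powQuot I n ⟶ X :=
  ModuleCat.ofHom (Submodule.liftQ (I ^ n) (LinearMap.toSpanSingleton R X x) hx)

lemma powQuotLift_mk {X : ModuleCat.{u} R} {n : ℕ} (x : X) (hx : ∀ r ∈ I ^ n, r • x = 0) (a : R) :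
    (powQuotLift x hx).hom (Submodule.Quotient.mk a) = a • x := rfl

lemma powQuot_hom_ext {X : ModuleCat.{u} R} {n : ℕ} {f g : powQuot I n ⟶ X}
    (h : f.hom (Submodule.Quotient.mk 1) = g.hom (Submodule.Quotient.mk 1)) : f = g := by
  apply ModuleCat.hom_ext
  refine Submodule.linearMap_qext _ (LinearMap.ext_ring ?_)
  exact h

lemma powQuotMap_mk {n m : ℕ} (h : n ≤ m) (a : R) :
    (powQuotMap I h).hom (Submodule.Quotient.mk a) = Submodule.Quotient.mk a := rfl

lemma smul_hom_powQuot_one {X : ModuleCat.{u} R} {n : ℕ} (f : powQuot I n ⟶ X) {r : R}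
    (hr : r ∈ I ^ n) : r • f.hom (Submodule.Quotient.mk 1) = 0 := by
  rw [← map_smul, pow_smul_powQuot_eq_zero hr, map_zero]

lemma extRes_mk₀ {X : ModuleCat.{u} R} {n m : ℕ} (h : n ≤ m) (f : powQuot I n ⟶ X) :
    extRes I X 0 h (Abelian.Ext.mk₀ f) = Abelian.Ext.mk₀ (powQuotMap I h ≫ f) :=
  Abelian.Ext.mk₀_comp_mk₀ _ _

lemma exists_comp_eq_extRes {X Y : ModuleCat.{u} R} (g : X ⟶ Y) [Epi g]
    (hX : powTorsion I X = ⊤) {n : ℕ} (w : Abelian.Ext (powQuot I n) Y 0) :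
    ∃ (m : ℕ) (h : n ≤ m) (v : Abelian.Ext (powQuot I m) X 0),
      v.comp (Abelian.Ext.mk₀ g) (add_zero 0) = extRes I Y 0 h w := by
  obtain ⟨w, rfl⟩ := (Abelian.Ext.mk₀_bijective _ _).2 w
  obtain ⟨x, hx⟩ := (ModuleCat.epi_iff_surjective g).1 inferInstance
    (w.hom (Submodule.Quotient.mk 1))
  obtain ⟨k, hk⟩ : x ∈ powTorsion I X := hX ▸ Submodule.mem_top
  refine ⟨n + k, by lia, Abelian.Ext.mk₀ (powQuotLift x fun r hr ↦
    hk r (Ideal.pow_le_pow_right (by lia) hr)), ?_⟩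
  rw [extRes_mk₀, Abelian.Ext.mk₀_comp_mk₀]
  congr 1
  apply powQuot_hom_ext
  rw [ModuleCat.hom_comp, ModuleCat.hom_comp, LinearMap.comp_apply, LinearMap.comp_apply,
    powQuotLift_mk, one_smul, powQuotMap_mk]
  exact hx

lemma powTorsion_eq_top_of_epi {X Y : ModuleCat.{u} R} (g : X ⟶ Y) [Epi g]
    (hX : powTorsion I X = ⊤) : powTorsion I Y = ⊤ := by
  refine eq_top_iff.2 fun y _ ↦ ?_
  obtain ⟨x, rfl⟩ := (ModuleCat.epi_iff_surjective g).1 inferInstance y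
  exact map_mem_powTorsion g.hom (hX ▸ Submodule.mem_top)

lemma isLocCohTorsion_of_powTorsion_eq_top [IsNoetherianRing R] (S : Submonoid R) (j : ℕ)
    (X : ModuleCat.{u} R) (hX : powTorsion I X = ⊤) : IsLocCohTorsion I S (j + 1) X := by
  let E := Injective.under X
  have hE' : Injective (ModuleCat.of R E) := inferInstanceAs (Injective (Injective.under X))
  have hE : Module.Injective R E := Module.injective_module_of_injective_object _ _
  have hG := injective_powTorsion I E
  have hG' : Injective (ModuleCat.of R (powTorsion I E)) :=
    Module.injective_object_of_injective_module _ _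
  have hι : Function.Injective (Injective.ι X).hom :=
    (ModuleCat.mono_iff_injective _).1 (Injective.ι_mono _)
  let f : X ⟶ ModuleCat.of R (powTorsion I E) := ModuleCat.ofHom
    ((Injective.ι X).hom.codRestrict _ fun x ↦ map_mem_powTorsion _ (hX ▸ Submodule.mem_top))
  have hf : Mono f := (ModuleCat.mono_iff_injective _).2 fun x y hxy ↦
    hι (congrArg Subtype.val hxy)
  have hC := cokerComplex_shortExact f
  have htop : powTorsion I (ModuleCat.of R (powTorsion I E)) = ⊤ := powTorsion_powTorsion
  cases j with
  | zero =>
    intro n z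
    obtain ⟨w, rfl⟩ := Abelian.Ext.covariant_sequence_exact₁ _ hC z
      (Abelian.Ext.eq_zero_of_injective _) rfl
    obtain ⟨m, h, v, hv⟩ := exists_comp_eq_extRes (Limits.cokernel.π f) htop w
    refine ⟨m, h, 1, S.one_mem, ?_⟩
    rw [one_smul, ← extRes_comp, ← hv,
      Abelian.Ext.comp_assoc_of_second_deg_zero]
    have : (Abelian.Ext.mk₀ (Limits.cokernel.π f)).comp hC.extClass (zero_add 1) = 0 :=
      hC.comp_extClass
    rw [this, Abelian.Ext.comp_zero]
  | succ j =>
    exact (isLocCohTorsion_of_injective (j := j + 1) _).of_X₂_X₃ hC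
      (isLocCohTorsion_of_powTorsion_eq_top S j _
        (powTorsion_eq_top_of_epi (Limits.cokernel.π f) htop))
  termination_by j

lemma ext_eq_zero_of_powTorsion_eq_bot {N E : ModuleCat.{u} R} [Injective E]
    (hE : powTorsion I E = ⊥) {k : ℕ} (hN : ∀ r ∈ I ^ k, ∀ x : N, r • x = 0) {i : ℕ}
    (z : Abelian.Ext N E i) : z = 0 := by
  cases i with
  | zero =>
    obtain ⟨f, rfl⟩ := (Abelian.Ext.mk₀_bijective _ _).2 z
    rw [Abelian.Ext.mk₀_eq_zero_iff]
    ext x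
    have : f.hom x ∈ powTorsion I E :=
      map_mem_powTorsion f.hom ⟨k, fun r hr ↦ hN r hr x⟩
    rwa [hE, Submodule.mem_bot] at this
  | succ i => exact Abelian.Ext.eq_zero_of_injective z

lemma isLocCohTorsion_of_powTorsion_eq_bot (S : Submonoid R) {E : ModuleCat.{u} R} [Injective E]
    (hE : powTorsion I E = ⊥) (j : ℕ) : IsLocCohTorsion I S j E := fun n z ↦
  ⟨n, le_rfl, 1, S.one_mem, by
    rw [ext_eq_zero_of_powTorsion_eq_bot hE (fun r hr x ↦ pow_smul_powQuot_eq_zero hr x) z,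
      map_zero, smul_zero]⟩

variable {S : Submonoid R}

lemma exists_smul_linearMap_eq_zero {N Y : Type*} [AddCommGroup N] [Module R N]
    [Module.Finite R N] [AddCommGroup Y] [Module R Y]
    (hY : ∀ y : Y, ∃ s ∈ S, s • y = 0) (f : N →ₗ[R] Y) : ∃ s ∈ S, s • f = 0 := by
  have key (P : Submodule R N) (hP : P.FG) : ∃ s ∈ S, ∀ x ∈ P, s • f x = 0 := by
    induction P, hP using Submodule.fg_induction with
    | singleton x =>
      obtain ⟨s, hs, h⟩ := hY (f x)
      refine ⟨s, hs, fun y hy ↦ ?_⟩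
      obtain ⟨a, rfl⟩ := Submodule.mem_span_singleton.1 hy
      rw [map_smul, smul_comm, h, smul_zero]
    | sup P Q _ _ h₁ h₂ =>
      obtain ⟨s, hs, hs'⟩ := h₁
      obtain ⟨t, ht, ht'⟩ := h₂
      refine ⟨s * t, S.mul_mem hs ht, fun y hy ↦ ?_⟩
      obtain ⟨a, ha, b, hb, rfl⟩ := Submodule.mem_sup.1 hy
      rw [map_add, smul_add, mul_smul, mul_smul, ht' b hb, smul_comm, hs' a ha]
      simp
  obtain ⟨s, hs, h⟩ := key ⊤ Module.Finite.fg_top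
  exact ⟨s, hs, LinearMap.ext fun x ↦ h x trivial⟩

lemma exists_smul_ext_eq_zero [IsNoetherianRing R] (N Y : ModuleCat.{u} R) [Module.Finite R N]
    (hY : ∀ y : Y, ∃ s ∈ S, s • y = 0) (i : ℕ) (z : Abelian.Ext N Y i) :
    ∃ s ∈ S, s • z = 0 := by
  induction i generalizing N with
  | zero =>
    obtain ⟨f, rfl⟩ := (Abelian.Ext.mk₀_bijective _ _).2 z
    obtain ⟨s, hs, h⟩ := exists_smul_linearMap_eq_zero hY f.hom
    refine ⟨s, hs, ?_⟩
    rw [← Abelian.Ext.mk₀_smul, Abelian.Ext.mk₀_eq_zero_iff]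
    exact ModuleCat.hom_ext h
  | succ i ih =>
    obtain ⟨P, _, _, _, _, f, hf⟩ := Module.exists_finite_presentation R N
    have hC := LinearMap.shortExact_shortComplexKer hf
    obtain ⟨w, rfl⟩ := precomp_extClass_surjective_of_projective_X₂ Y hC i z
    obtain ⟨s, hs, h⟩ := ih (ModuleCat.of R (LinearMap.ker f)) w
    refine ⟨s, hs, ?_⟩
    change s • hC.extClass.comp w (add_comm 1 i) = 0
    rw [← Abelian.Ext.comp_smul, h, Abelian.Ext.comp_zero]

lemma IsLocCohTorsion.exists_smul_eq_zero {X : ModuleCat.{u} R} (h : IsLocCohTorsion I S 0 X)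
    {x : X} (hx : x ∈ powTorsion I X) : ∃ s ∈ S, s • x = 0 := by
  obtain ⟨n, hn⟩ := hx
  obtain ⟨m, hm, s, hs, e⟩ := h n (Abelian.Ext.mk₀ (powQuotLift x hn))
  refine ⟨s, hs, ?_⟩
  rw [extRes_mk₀, ← Abelian.Ext.mk₀_smul, Abelian.Ext.mk₀_eq_zero_iff] at e
  have h1 : s • (1 : R) • x = 0 := congrArg (fun f ↦ f.hom (Submodule.Quotient.mk 1)) e
  rwa [one_smul] at h1

lemma exists_smul_ext_eq_zero_of_exists_smul_comp_eq_zero [IsNoetherianRing R]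
    (N : ModuleCat.{u} R) [Module.Finite R N] (i : ℕ)
    (X : ModuleCat.{u} R) (hX : IsLocCohTorsion I S 0 X) (z : Abelian.Ext N X i)
    (hz : ∃ s ∈ S, s • z.comp (Abelian.Ext.mk₀ (quotComplex (powTorsion I X)).g) (add_zero i) = 0) :
    ∃ s ∈ S, s • z = 0 := by
  obtain ⟨s, hs, h⟩ := hz
  rw [← Abelian.Ext.smul_comp] at h
  obtain ⟨w, hw⟩ := Abelian.Ext.covariant_sequence_exact₂ _
    (quotComplex_shortExact (powTorsion I X)) _ h
  obtain ⟨t, ht, e⟩ := exists_smul_ext_eq_zero (S := S) N (ModuleCat.of R (powTorsion I X))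
    (fun y ↦ (hX.exists_smul_eq_zero y.2).imp fun s hs ↦ ⟨hs.1, Subtype.ext hs.2⟩) i w
  exact ⟨t * s, S.mul_mem ht hs, by
    rw [mul_smul, ← hw, ← Abelian.Ext.smul_comp, e, Abelian.Ext.zero_comp]⟩

lemma IsLocCohTorsion.quotient_powTorsion [IsNoetherianRing R] {j : ℕ} {X : ModuleCat.{u} R}
    (hX : IsLocCohTorsion I S j X) :
    IsLocCohTorsion I S j (ModuleCat.of R (X ⧸ powTorsion I X)) :=
  hX.of_X₂_X₁ (quotComplex_shortExact (powTorsion I X))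
    (isLocCohTorsion_of_powTorsion_eq_top S j _ powTorsion_powTorsion)

lemma exists_smul_ext_eq_zero_of_isLocCohTorsion [IsNoetherianRing R] (N : ModuleCat.{u} R)
    [Module.Finite R N] {k : ℕ} (hN : ∀ r ∈ I ^ k, ∀ x : N, r • x = 0) (i : ℕ)
    (X : ModuleCat.{u} R) (hX : ∀ j ≤ i, IsLocCohTorsion I S j X) (z : Abelian.Ext N X i) :
    ∃ s ∈ S, s • z = 0 := by
  induction i generalizing X with
  | zero =>
    obtain ⟨E, f, _, _, hE⟩ := exists_injective_powTorsion_eq_bot I (X ⧸ powTorsion I X)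
      powTorsion_quotient
    refine exists_smul_ext_eq_zero_of_exists_smul_comp_eq_zero N 0 X (hX 0 le_rfl) z
      ⟨1, S.one_mem, ?_⟩
    rw [one_smul]
    exact Abelian.Ext.postcomp_mk₀_injective_of_mono _ f
      ((ext_eq_zero_of_powTorsion_eq_bot hE hN _).trans (map_zero _).symm)
  | succ i ih =>
    obtain ⟨E, f, _, _, hE⟩ := exists_injective_powTorsion_eq_bot I (X ⧸ powTorsion I X)
      powTorsion_quotient
    refine exists_smul_ext_eq_zero_of_exists_smul_comp_eq_zero N (i + 1) X (hX 0 (by lia)) z ?_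
    obtain ⟨w, hw⟩ := Abelian.Ext.covariant_sequence_exact₁ _ (cokerComplex_shortExact f)
      (z.comp (Abelian.Ext.mk₀ (quotComplex (powTorsion I X)).g) (add_zero _))
      (ext_eq_zero_of_powTorsion_eq_bot hE hN _) rfl
    obtain ⟨s, hs, h⟩ := ih _ (fun j hj ↦
      (isLocCohTorsion_of_powTorsion_eq_bot S hE j).of_X₂_X₁ (cokerComplex_shortExact f)
        (hX (j + 1) (by lia)).quotient_powTorsion) w
    exact ⟨s, hs, by rw [← hw, ← Abelian.Ext.smul_comp, h, Abelian.Ext.zero_comp]⟩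

lemma IsLocCohTorsion.of_isSMulRegular {Y : ModuleCat.{u} R} {x : R} (hx : x ∈ I)
    (hreg : IsSMulRegular Y x) {j : ℕ}
    (h : ∀ n, IsLocCohTorsion I S j (ModuleCat.of R (QuotSMulTop (x ^ (n + 1)) Y))) :
    IsLocCohTorsion I S (j + 1) Y := by
  intro n z
  have hC := (hreg.pow (n + 1)).smulShortComplex_shortExact
  have h0 : z.comp (Abelian.Ext.mk₀ (Y.smulShortComplex (x ^ (n + 1))).f) (add_zero _) = 0 := by
    rw [ModuleCat.smulShortComplex_f_eq_smul_id]
    exact (Abelian.Ext.smul_eq_comp_mk₀ _ _).symm.trans (ext_smul_eq_zero_of_left _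
      (pow_smul_powQuot_eq_zero (Ideal.pow_le_pow_right n.le_succ
        (Ideal.pow_mem_pow hx (n + 1)))) _)
  obtain ⟨w, hw⟩ := Abelian.Ext.covariant_sequence_exact₁ _ hC z h0 rfl
  obtain ⟨m, hm, s, hs, e⟩ := h n n w
  have e' : s • extRes I (Y.smulShortComplex (x ^ (n + 1))).X₁ (j + 1) hm
      (w.comp hC.extClass rfl) = 0 := by
    rw [← extRes_comp, ← Abelian.Ext.smul_comp]
    exact (congrArg (fun v ↦ Abelian.Ext.comp v hC.extClass rfl) e).trans
      (Abelian.Ext.zero_comp _ _ _ _ rfl)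
  exact ⟨m, hm, s, hs, by rwa [hw] at e'⟩

end TorsionVanishing

section PrimeChains

variable {R : Type*} [CommRing R]

lemma two_le_supportDim_of_lt {L : Type*} [AddCommGroup L] [Module R L] [Module.Finite R L]
    {a b c : PrimeSpectrum R} (ha : Module.annihilator R L ≤ a.asIdeal) (hab : a < b)
    (hbc : b < c) : 2 ≤ Module.supportDim R L := by
  have ha' : a ∈ Module.support R L := Module.mem_support_iff_of_finite.2 ha
  have hb' := Module.mem_support_mono hab.le ha'
  have hc' := Module.mem_support_mono hbc.le hb'
  let l : LTSeries (Module.support R L) := ⟨2, ![⟨a, ha'⟩, ⟨b, hb'⟩, ⟨c, hc'⟩], fun i ↦ by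
    fin_cases i
    · exact hab
    · exact hbc⟩
  exact Order.LTSeries.length_le_krullDim l

lemma three_le_supportDim_of_lt {L : Type*} [AddCommGroup L] [Module R L] [Module.Finite R L]
    {a b c d : PrimeSpectrum R} (ha : Module.annihilator R L ≤ a.asIdeal) (hab : a < b)
    (hbc : b < c) (hcd : c < d) : 3 ≤ Module.supportDim R L := by
  have ha' : a ∈ Module.support R L := Module.mem_support_iff_of_finite.2 ha
  have hb' := Module.mem_support_mono hab.le ha'
  have hc' := Module.mem_support_mono hbc.le hb'
  have hd' := Module.mem_support_mono hcd.le hc'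
  let l : LTSeries (Module.support R L) :=
    ⟨3, ![⟨a, ha'⟩, ⟨b, hb'⟩, ⟨c, hc'⟩, ⟨d, hd'⟩], fun i ↦ by
      fin_cases i
      · exact hab
      · exact hbc
      · exact hcd⟩
  exact Order.LTSeries.length_le_krullDim l

lemma lt_closedPoint [IsLocalRing R] {q : PrimeSpectrum R} (hq : q ≠ IsLocalRing.closedPoint R) :
    q < IsLocalRing.closedPoint R :=
  lt_of_le_of_ne (IsLocalRing.le_maximalIdeal q.2.ne_top) hq

end PrimeChains

section FiniteModules

variable {R : Type u} [CommRing R] [IsNoetherianRing R] {I : Ideal R}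

lemma isLocCohTorsion_of_forall_exists_smul {S : Submonoid R} {Y : ModuleCat.{u} R}
    (hY : ∀ y : Y, ∃ s ∈ S, s • y = 0) (j : ℕ) : IsLocCohTorsion I S j Y := fun n z ↦
  let ⟨s, hs, h⟩ := exists_smul_ext_eq_zero (S := S) (powQuot I n) Y hY j z
  ⟨n, le_rfl, s, hs, by rw [← map_smul, h, map_zero]⟩

/-- If `I` is contained in every prime of the support of `L` below `q`, then the higher local
cohomology of `L` vanishes at `q`. -/
lemma isLocCohTorsion_primeCompl (L : ModuleCat.{u} R) [Module.Finite R L] (q : Ideal R)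
    [q.IsPrime] (h : ∀ p : Ideal R, p.IsPrime → Module.annihilator R L ≤ p → p ≤ q → I ≤ p)
    (j : ℕ) : IsLocCohTorsion I q.primeCompl (j + 1) L := by
  let T := Submodule.torsion' R L q.primeCompl
  have hrad : I ≤ (Module.annihilator R (L ⧸ T)).radical := by
    intro r hr
    by_contra! H
    have hdisj : Disjoint (Module.annihilator R L : Set R)
        (q.primeCompl ⊔ Submonoid.powers r : Submonoid R) := by
      rw [Set.disjoint_left]
      intro a ha ha'
      obtain ⟨s, hs, _, ⟨n, rfl⟩, rfl⟩ := Submonoid.mem_sup.1 ha'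
      refine H ⟨n, Module.mem_annihilator.2 fun y ↦ ?_⟩
      obtain ⟨y, rfl⟩ := T.mkQ_surjective y
      rw [← map_smul, Submodule.mkQ_apply, Submodule.Quotient.mk_eq_zero]
      refine ⟨⟨s, hs⟩, ?_⟩
      change s • r ^ n • y = 0
      rw [← mul_smul]
      exact Module.mem_annihilator.1 ha y
    obtain ⟨p, hp, hLp, hpd⟩ := Ideal.exists_le_prime_disjoint _ _ hdisj
    rw [Set.disjoint_left] at hpd
    refine hpd (h p hp hLp (fun a ha ↦ ?_) hr)
      (le_sup_right (a := q.primeCompl) (Submonoid.mem_powers r))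
    by_contra haq
    exact hpd ha (le_sup_left (b := Submonoid.powers r) haq)
  obtain ⟨n, hn⟩ := Ideal.exists_pow_le_of_le_radical_of_fg hrad (IsNoetherian.noetherian I)
  have hT (y : T) : ∃ s ∈ q.primeCompl, s • y = 0 :=
    let ⟨s, hs⟩ := y.2
    ⟨s, s.2, Subtype.ext hs⟩
  exact (isLocCohTorsion_of_forall_exists_smul (Y := ModuleCat.of R T) hT _).of_X₁_X₃
    (quotComplex_shortExact T)
    (isLocCohTorsion_of_powTorsion_eq_top _ j _ (eq_top_iff.2 fun y _ ↦
      ⟨n, fun r hr ↦ Module.mem_annihilator.1 (hn hr) y⟩))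

lemma exists_isSMulRegular_of_powTorsion_eq_bot (Y : Type u) [AddCommGroup Y] [Module R Y]
    [Module.Finite R Y] (hY : powTorsion I Y = ⊥) : ∃ x ∈ I, IsSMulRegular Y x := by
  have : Subsingleton ((R ⧸ I) →ₗ[R] Y) := by
    refine subsingleton_of_forall_eq 0 fun f ↦ LinearMap.ext fun x ↦ ?_
    have : f x ∈ powTorsion I Y := ⟨1, fun r hr ↦ by
      rw [pow_one] at hr
      obtain ⟨x, rfl⟩ := Ideal.Quotient.mk_surjective x
      rw [← map_smul]
      convert map_zero f
      exact Ideal.Quotient.eq_zero_iff_mem.2 (Ideal.mul_mem_right x _ hr)⟩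
    rwa [hY] at this
  obtain ⟨x, hx, h⟩ := IsSMulRegular.subsingleton_linearMap_iff.1 this
  exact ⟨x, by rwa [Ideal.annihilator_quotient] at hx, h⟩

lemma IsLocCohTorsion.of_quotient_powTorsion {S : Submonoid R} {X : ModuleCat.{u} R} {j : ℕ}
    (h : IsLocCohTorsion I S (j + 1) (ModuleCat.of R (X ⧸ powTorsion I X))) :
    IsLocCohTorsion I S (j + 1) X :=
  (isLocCohTorsion_of_powTorsion_eq_top S j (ModuleCat.of R (powTorsion I X))
    powTorsion_powTorsion).of_X₁_X₃ (quotComplex_shortExact (powTorsion I X)) h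

variable [IsLocalRing R]

lemma supportDim_quotSMulTop_le {Y : Type u} [AddCommGroup Y] [Module R Y]
    [Module.Finite R Y] {x : R} (hx : x ∈ IsLocalRing.maximalIdeal R) (hreg : IsSMulRegular Y x)
    {d : ℕ} (hd : Module.supportDim R Y ≤ (d + 1 : ℕ)) :
    Module.supportDim R (QuotSMulTop x Y) ≤ d := by
  rw [← Module.supportDim_quotSMulTop_succ_eq_supportDim hreg hx] at hd
  generalize Module.supportDim R (QuotSMulTop x Y) = e at hd
  induction e using WithBot.recBotCoe with
  | bot => exact bot_le
  | coe e =>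
    norm_cast at hd ⊢
    exact (ENat.add_le_add_iff_right ENat.one_ne_top).1 (by exact_mod_cast hd)

lemma isLocCohTorsion_of_supportDim_le {q : PrimeSpectrum R}
    (hq : q ≠ IsLocalRing.closedPoint R) (d : ℕ) (M : ModuleCat.{u} R) [Module.Finite R M]
    (hM : Module.supportDim R M ≤ (d + 1 : ℕ)) (j : ℕ) (hj : d ≤ j) :
    IsLocCohTorsion I q.asIdeal.primeCompl (j + 1) M := by
  by_cases hI : I ≤ q.asIdeal
  swap
  · obtain ⟨s, hs, hs'⟩ := SetLike.not_le_iff_exists.1 hI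
    exact isLocCohTorsion_of_mem M hs' hs
  induction d generalizing M j with
  | zero =>
    refine isLocCohTorsion_primeCompl M _ (fun p hp hMp hpq ↦ ?_) j
    rcases hpq.eq_or_lt with rfl | hlt
    · exact hI
    · have := (two_le_supportDim_of_lt (a := ⟨p, hp⟩) hMp hlt (lt_closedPoint hq)).trans hM
      norm_cast at this
  | succ d ih =>
    obtain ⟨j, rfl⟩ : ∃ j', j = j' + 1 := ⟨j - 1, by lia⟩
    apply IsLocCohTorsion.of_quotient_powTorsion
    obtain ⟨x, hxI, hx⟩ := exists_isSMulRegular_of_powTorsion_eq_bot (I := I)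
      (M ⧸ powTorsion I M) powTorsion_quotient
    refine IsLocCohTorsion.of_isSMulRegular hxI hx fun n ↦ ih _ ?_ j (by lia)
    exact supportDim_quotSMulTop_le
      (Ideal.pow_mem_of_mem _ ((hI.trans (IsLocalRing.le_maximalIdeal q.2.ne_top)) hxI) _
        n.succ_pos)
      (hx.pow _) ((Module.supportDim_le_of_surjective _ (Submodule.mkQ_surjective _)).trans hM)

lemma exists_finite_isLocCohTorsion (hI : I ≠ ⊤) (M : ModuleCat.{u} R) [Module.Finite R M]
    (hM : Module.supportDim R M ≤ 3) :
    ∃ W : Set (PrimeSpectrum R), W.Finite ∧ ∀ q ∉ W, ∀ j,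
      IsLocCohTorsion I q.asIdeal.primeCompl (j + 2) M := by
  have hIm := IsLocalRing.le_maximalIdeal hI
  obtain ⟨x, hxI, hx⟩ := exists_isSMulRegular_of_powTorsion_eq_bot (I := I)
    (M ⧸ powTorsion I M) powTorsion_quotient
  let L := QuotSMulTop x (M ⧸ powTorsion I M)
  have hL : Module.supportDim R L ≤ (2 : ℕ) := supportDim_quotSMulTop_le (hIm hxI) hx
    ((Module.supportDim_le_of_surjective _ (Submodule.mkQ_surjective _)).trans hM)
  refine ⟨insert (IsLocalRing.closedPoint R)
    (PrimeSpectrum.asIdeal ⁻¹' ⋃ p ∈ (Module.annihilator R L).minimalPrimes,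
      (p ⊔ I).minimalPrimes), ?_, fun q hq j ↦ ?_⟩
  · exact (((Ideal.finite_minimalPrimes_of_isNoetherianRing R _).biUnion fun p _ ↦
      Ideal.finite_minimalPrimes_of_isNoetherianRing R _).preimage
        fun _ _ _ _ h ↦ PrimeSpectrum.ext h).insert _
  rw [Set.mem_insert_iff, not_or] at hq
  cases j with
  | succ j => exact isLocCohTorsion_of_supportDim_le hq.1 2 M hM (j + 2) (by lia)
  | zero =>
    by_cases hIq : I ≤ q.asIdeal
    swap
    · obtain ⟨s, hs, hs'⟩ := SetLike.not_le_iff_exists.1 hIq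
      exact isLocCohTorsion_of_mem M hs' hs
    apply IsLocCohTorsion.of_quotient_powTorsion
    refine IsLocCohTorsion.of_isSMulRegular hxI hx fun n ↦
      isLocCohTorsion_primeCompl _ _ (fun p hp hLp hpq ↦ ?_) 0
    have hpL : Module.annihilator R L ≤ p := by
      have h1 : (⟨p, hp⟩ : PrimeSpectrum R) ∈
          Module.support R (QuotSMulTop (x ^ (n + 1)) (M ⧸ powTorsion I M)) :=
        Module.mem_support_iff_of_finite.2 hLp
      rw [Module.support_quotSMulTop] at h1
      refine Module.mem_support_iff_of_finite.1
        (show (⟨p, hp⟩ : PrimeSpectrum R) ∈ Module.support R L from ?_)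
      rw [Module.support_quotSMulTop]
      exact ⟨h1.1, by simpa using h1.2⟩
    by_contra hIp
    obtain ⟨p₀, hp₀, hp₀p⟩ := Ideal.exists_minimalPrimes_le hpL
    obtain ⟨q', hq', hq'q⟩ := Ideal.exists_minimalPrimes_le
      (sup_le (hp₀p.trans hpq) hIq)
    have h1 : p₀ < q' := lt_of_le_of_ne (le_sup_left.trans hq'.1.2) fun h ↦
      hIp ((le_sup_right.trans (hq'.1.2.trans_eq h.symm)).trans hp₀p)
    have h2 : q' < q.asIdeal := lt_of_le_of_ne hq'q fun h ↦
      hq.2 (Set.mem_biUnion hp₀ (h ▸ hq'))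
    have := (three_le_supportDim_of_lt (a := ⟨p₀, hp₀.1.1⟩) (b := ⟨q', hq'.1.1⟩) hp₀.1.2 h1 h2
      (lt_closedPoint hq.1)).trans hL
    norm_cast at this

end FiniteModules

section LinearRelations

variable {R : Type*} [Ring R] {A B : Type*} [AddCommGroup A] [Module R A] [AddCommGroup B]
  [Module R B]

/-- A linear relation that is total and injective in both directions is the graph of an injective
linear map. -/
lemma exists_injective_linearMap_of_relation (K : Submodule R (A × B))
    (htot : ∀ a, ∃ b, (a, b) ∈ K) (h0 : ∀ a b, (a, b) ∈ K → (a = 0 ↔ b = 0)) :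
    ∃ f : A →ₗ[R] B, Function.Injective f ∧ ∀ b, b ∈ LinearMap.range f ↔ ∃ a, (a, b) ∈ K := by
  let e : K ≃ₗ[R] A := LinearEquiv.ofBijective (LinearMap.fst R A B ∘ₗ K.subtype) <| by
    refine ⟨(injective_iff_map_eq_zero _).2 ?_, fun a ↦ ?_⟩
    · rintro ⟨⟨a, b⟩, hK⟩ (h : a = 0)
      subst h
      exact Subtype.ext (Prod.ext rfl ((h0 0 b hK).1 rfl))
    · obtain ⟨b, hb⟩ := htot a
      exact ⟨⟨(a, b), hb⟩, rfl⟩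
  refine ⟨LinearMap.snd R A B ∘ₗ K.subtype ∘ₗ e.symm.toLinearMap,
    (injective_iff_map_eq_zero _).2 fun a ha ↦ ?_, fun b ↦ ⟨?_, ?_⟩⟩
  · have h1 : ((e.symm a).1.1, (e.symm a).1.2) ∈ K := (e.symm a).2
    have h2 : (e.symm a).1.1 = a := e.apply_symm_apply a
    rw [← h2]
    exact (h0 _ _ h1).2 ha
  · rintro ⟨a, rfl⟩
    exact ⟨_, (e.symm a).2⟩
  · rintro ⟨a, h⟩
    exact ⟨e ⟨(a, b), h⟩, by simp⟩

end LinearRelations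

section FirstLocalCohomology

variable {R : Type u} [CommRing R] [IsNoetherianRing R] {I : Ideal R} {X : ModuleCat.{u} R}
  {E : ModuleCat.{u} R}

/-- If the `I`-torsion free quotient of `X` embeds in an `I`-torsion free injective module `E`,
then `H^1_I(X)` is the `I`-torsion of the cokernel. -/
lemma exists_injective_linearMap_localCohomology_one [Injective E] (hE : powTorsion I E = ⊥)
    (f : ModuleCat.of R (X ⧸ powTorsion I X) ⟶ E) [Mono f] :
    ∃ g : ↥((localCohomology I 1).obj X) →ₗ[R] ↥(Limits.cokernel f), Function.Injective g ∧
      LinearMap.range g = powTorsion I ↥(Limits.cokernel f) := by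
  obtain ⟨φ, hφ, hφs, hφz⟩ := exists_toLocalCohomology I X 1
  have hD := cokerComplex_shortExact f
  have hQ := quotComplex_shortExact (powTorsion I X)
  let p : X ⟶ ModuleCat.of R (X ⧸ powTorsion I X) := (quotComplex (powTorsion I X)).g
  let δ : Abelian.Ext (Limits.cokernel f) (ModuleCat.of R (X ⧸ powTorsion I X)) 1 := hD.extClass
  have hext {n i : ℕ} (z : Abelian.Ext (powQuot I n) E i) : z = 0 :=
    ext_eq_zero_of_powTorsion_eq_bot hE (fun r hr x ↦ pow_smul_powQuot_eq_zero hr x) z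
  let Rel (n : ℕ) (z : Abelian.Ext (powQuot I n) X 1) (c : powQuot I n ⟶ Limits.cokernel f) :
      Prop := z.comp (Abelian.Ext.mk₀ p) (add_zero 1) =
        (Abelian.Ext.mk₀ c).comp δ (zero_add 1)
  have raise {n m : ℕ} (h : n ≤ m) {z c} (hR : Rel n z c) :
      Rel m (extRes I X 1 h z) (powQuotMap I h ≫ c) := by
    change (extRes I X 1 h z).comp _ _ = _
    rw [extRes_comp, hR, ← extRes_mk₀, extRes_comp]
  have radd {n : ℕ} {z z' c c'} (h : Rel n z c) (h' : Rel n z' c') : Rel n (z + z') (c + c') := by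
    change (z + z').comp _ _ = _
    rw [Abelian.Ext.add_comp, h, h', ← Abelian.Ext.add_comp, Abelian.Ext.mk₀_add]
  have rsmul {n : ℕ} (r : R) {z c} (h : Rel n z c) : Rel n (r • z) (r • c) := by
    change (r • z).comp _ _ = _
    rw [Abelian.Ext.smul_comp, h, ← Abelian.Ext.smul_comp, Abelian.Ext.mk₀_smul]
  let K : Submodule R (↥((localCohomology I 1).obj X) × ↥(Limits.cokernel f)) :=
    { carrier := {y | ∃ n z c, Rel n z c ∧ φ n z = y.1 ∧ c.hom (Submodule.Quotient.mk 1) = y.2}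
      zero_mem' := ⟨0, 0, 0, by
        change Abelian.Ext.comp 0 _ _ = _
        rw [Abelian.Ext.zero_comp, Abelian.Ext.mk₀_zero, Abelian.Ext.zero_comp], by simp, by simp⟩
      add_mem' := by
        rintro _ _ ⟨n, z, c, h, h1, h2⟩ ⟨n', z', c', h', h1', h2'⟩
        refine ⟨n + n', _, _, radd (raise (n.le_add_right n') h) (raise (n'.le_add_left n) h'),
          ?_, ?_⟩
        · rw [map_add, hφ, hφ, h1, h1']
          rfl
        · rw [Prod.snd_add, ← h2, ← h2']
          rfl
      smul_mem' := by
        rintro r _ ⟨n, z, c, h, h1, h2⟩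
        refine ⟨n, _, _, rsmul r h, ?_, ?_⟩
        · rw [map_smul, h1]
          rfl
        · rw [Prod.smul_snd, ← h2]
          rfl }
  obtain ⟨g, hg, hgr⟩ := exists_injective_linearMap_of_relation K (fun a ↦ by
    obtain ⟨n, z, rfl⟩ := hφs a
    obtain ⟨w, hw⟩ := Abelian.Ext.covariant_sequence_exact₁ _ hD
      (z.comp (Abelian.Ext.mk₀ p) (add_zero 1)) (hext _) (zero_add 1)
    obtain ⟨c, rfl⟩ := (Abelian.Ext.mk₀_bijective _ _).2 w
    exact ⟨_, n, z, c, hw.symm, rfl, rfl⟩) (by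
    rintro _ _ ⟨n, z, c, h, rfl, rfl⟩
    constructor
    · intro h0
      obtain ⟨m, hm, e⟩ := hφz _ _ h0
      have h' := raise hm h
      change (extRes I X 1 hm z).comp _ _ = _ at h'
      rw [e, Abelian.Ext.zero_comp] at h'
      obtain ⟨w, hw⟩ := Abelian.Ext.covariant_sequence_exact₃ _ hD _ (zero_add 1) h'.symm
      rw [hext w, Abelian.Ext.zero_comp] at hw
      have := (Abelian.Ext.mk₀_eq_zero_iff _).1 hw.symm
      have h1 := congrArg (fun f ↦ f.hom (Submodule.Quotient.mk 1)) this
      exact h1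
    · intro h0
      have hc : c = 0 := powQuot_hom_ext h0
      rw [hc] at h
      change z.comp _ _ = _ at h
      rw [Abelian.Ext.mk₀_zero, Abelian.Ext.zero_comp] at h
      obtain ⟨w, hw⟩ := Abelian.Ext.covariant_sequence_exact₂ _ hQ _ h
      obtain ⟨m, hm, s, hs, e⟩ := isLocCohTorsion_of_powTorsion_eq_top (I := I) (⊥ : Submonoid R) 0
        (ModuleCat.of R (powTorsion I X)) powTorsion_powTorsion n w
      rw [Submonoid.mem_bot.1 hs, one_smul] at e
      rw [← hφ n m hm, ← hw]
      have e2 : extRes I X 1 hm (w.comp (Abelian.Ext.mk₀ (quotComplex (powTorsion I X)).f)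
          (add_zero 1)) = 0 := by
        refine (extRes_comp _ _ _ _).symm.trans ?_
        exact (congrArg (fun t ↦ Abelian.Ext.comp t _ _) e).trans (Abelian.Ext.zero_comp _ _ _ _ _)
      exact (congrArg _ e2).trans (map_zero _))
  refine ⟨g, hg, Submodule.ext fun b ↦ (hgr b).trans ⟨?_, ?_⟩⟩
  · rintro ⟨a, n, z, c, -, -, rfl⟩
    exact ⟨n, fun r hr ↦ smul_hom_powQuot_one c hr⟩
  · rintro ⟨n, hn⟩
    let c := powQuotLift b hn
    have hc : c.hom (Submodule.Quotient.mk 1) = b := one_smul R b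
    let t := (Abelian.Ext.mk₀ c).comp δ (zero_add 1)
    obtain ⟨m, hm, s, hs, e⟩ := isLocCohTorsion_of_powTorsion_eq_top (I := I) (⊥ : Submonoid R) 1
        (ModuleCat.of R (powTorsion I X)) powTorsion_powTorsion n (t.comp hQ.extClass rfl)
    rw [Submonoid.mem_bot.1 hs, one_smul, ← extRes_comp] at e
    obtain ⟨w, hw⟩ := Abelian.Ext.covariant_sequence_exact₃ _ hQ _ rfl e
    refine ⟨φ m w, m, w, powQuotMap I hm ≫ c, ?_, rfl, hc⟩
    refine hw.trans ?_
    rw [← extRes_comp, extRes_mk₀]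

end FirstLocalCohomology

section FiniteAssociatedPrimes

lemma associatedPrimes_finite_of_exists_smul_eq_zero {R A : Type*} [CommRing R]
    [IsNoetherianRing R] [AddCommGroup A] [Module R A] {W : Set (PrimeSpectrum R)}
    (hW : W.Finite) (h : ∀ q ∉ W, ∀ a : A, ∃ s ∈ q.asIdeal.primeCompl, s • a = 0) :
    (associatedPrimes R A).Finite := by
  refine (hW.image PrimeSpectrum.asIdeal).subset fun p hp ↦ ?_
  obtain ⟨hp, x, hx⟩ := isAssociatedPrime_iff.1 hp
  by_contra hpW
  obtain ⟨s, hs, e⟩ := h ⟨p, hp⟩ (fun h ↦ hpW ⟨_, h, rfl⟩) x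
  refine hs ?_
  change s ∈ p
  rw [hx, Submodule.mem_colon_singleton, e]
  exact Submodule.zero_mem _

variable {R : Type u} [CommRing R] {I : Ideal R}

lemma exists_pow_smul_localCohomology_eq_zero {X : ModuleCat.{u} R} {j : ℕ}
    (y : ↥((localCohomology I j).obj X)) : ∃ n, ∀ r ∈ I ^ n, r • y = 0 := by
  obtain ⟨φ, -, hφs, -⟩ := exists_toLocalCohomology I X j
  obtain ⟨n, z, rfl⟩ := hφs y
  exact ⟨n, fun r hr ↦ by
    rw [← map_smul, ext_smul_eq_zero_of_left r (pow_smul_powQuot_eq_zero hr) z, map_zero]⟩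

lemma IsLocCohTorsion.exists_smul_localCohomology_eq_zero {S : Submonoid R} {X : ModuleCat.{u} R}
    {j : ℕ} (h : IsLocCohTorsion I S j X) (y : ↥((localCohomology I j).obj X)) :
    ∃ s ∈ S, s • y = 0 := by
  obtain ⟨φ, hφ, hφs, -⟩ := exists_toLocalCohomology I X j
  obtain ⟨n, z, rfl⟩ := hφs y
  obtain ⟨m, hm, s, hs, e⟩ := h n z
  exact ⟨s, hs, by rw [← hφ n m hm, ← map_smul, e, map_zero]⟩

lemma exists_pow_smul_eq_zero_of_support_subset [IsNoetherianRing R] {N : Type*} [AddCommGroup N]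
    [Module R N] [Module.Finite R N]
    (hN : Module.support R N ⊆ PrimeSpectrum.zeroLocus (I : Set R)) :
    ∃ k, ∀ r ∈ I ^ k, ∀ x : N, r • x = 0 := by
  rw [Module.support_eq_zeroLocus, PrimeSpectrum.zeroLocus_subset_zeroLocus_iff] at hN
  obtain ⟨k, hk⟩ := Ideal.exists_pow_le_of_le_radical_of_fg hN (IsNoetherian.noetherian I)
  exact ⟨k, fun r hr ↦ Module.mem_annihilator.1 (hk hr)⟩

variable [IsNoetherianRing R]

lemma finite_localCohomology_zero (X : ModuleCat.{u} R) [Module.Finite R X] :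
    Module.Finite R ↥((localCohomology I 0).obj X) := by
  obtain ⟨φ, hφ, hφs, -⟩ := exists_toLocalCohomology I X 0
  obtain ⟨k, hk⟩ := exists_pow_smul_eq_zero_of_fg (I := I) (powTorsion I X)
    (IsNoetherian.noetherian _) le_rfl
  have := ModuleCat.finite_ext R (powQuot I k) X 0
  refine Module.Finite.of_surjective (φ k) fun y ↦ ?_
  obtain ⟨n, z, rfl⟩ := hφs y
  obtain ⟨f, rfl⟩ := (Abelian.Ext.mk₀_bijective _ _).2 z
  have hf : f.hom (Submodule.Quotient.mk 1) ∈ powTorsion I X :=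
    ⟨n, fun r hr ↦ smul_hom_powQuot_one f hr⟩
  refine ⟨Abelian.Ext.mk₀ (powQuotLift _ fun r hr ↦ hk r hr _ hf), ?_⟩
  rw [← hφ k (n + k) (k.le_add_left n), ← hφ n (n + k) (n.le_add_right k), extRes_mk₀, extRes_mk₀]
  congr 2
  exact powQuot_hom_ext (one_smul R _)

lemma associatedPrimes_ext_localCohomology_one_finite (N X : ModuleCat.{u} R) [Module.Finite R N]
    [Module.Finite R X] {k : ℕ} (hN : ∀ r ∈ I ^ k, ∀ x : N, r • x = 0)
    {W : Set (PrimeSpectrum R)} (hW : W.Finite)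
    (h : ∀ q ∉ W, ∀ j, IsLocCohTorsion I q.asIdeal.primeCompl (j + 2) X) (i : ℕ) :
    (associatedPrimes R (Abelian.Ext N ((localCohomology I 1).obj X) i)).Finite := by
  obtain ⟨E, f, _, _, hE⟩ := exists_injective_powTorsion_eq_bot I (X ⧸ powTorsion I X)
    powTorsion_quotient
  obtain ⟨g, hg, hgr⟩ := exists_injective_linearMap_localCohomology_one hE f
  have hD := cokerComplex_shortExact f
  have hexact : Function.Exact g (powTorsion I ↥(Limits.cokernel f)).mkQ := by
    rw [LinearMap.exact_iff, Submodule.ker_mkQ, hgr]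
  let T : ShortComplex (ModuleCat.{u} R) :=
    ModuleCat.shortComplexOfCompEqZero g _ hexact.linearMap_comp_eq_zero
  have hT : T.ShortExact := ModuleCat.shortComplex_shortExact _ hexact hg
    (Submodule.mkQ_surjective _)
  have hfin : Module.Finite R (Abelian.Ext N (Limits.cokernel f) i) := by
    have : Module.Finite R (ModuleCat.of R (X ⧸ powTorsion I X)) :=
      inferInstanceAs (Module.Finite R (X ⧸ powTorsion I X))
    have := ModuleCat.finite_ext R N (ModuleCat.of R (X ⧸ powTorsion I X)) (i + 1)
    refine Module.Finite.of_injective (hD.extClass.postcompOfLinear R N rfl)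
      ((injective_iff_map_eq_zero _).2 fun z hz ↦ ?_)
    obtain ⟨w, rfl⟩ := Abelian.Ext.covariant_sequence_exact₃ _ hD z rfl hz
    rw [ext_eq_zero_of_powTorsion_eq_bot hE hN w, Abelian.Ext.zero_comp]
  let L : Abelian.Ext N T.X₁ i →ₗ[R] Abelian.Ext N (Limits.cokernel f) i :=
    (Abelian.Ext.mk₀ T.f).postcompOfLinear R N (add_zero i)
  refine Set.Finite.subset ?_ (associatedPrimes.subset_union_of_exact
    (LinearMap.ker L).subtype_injective (L.exact_subtype_ker_map))
  refine (associatedPrimes_finite_of_exists_smul_eq_zero hW ?_).union (associatedPrimes.finite R _)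
  rintro q hq ⟨z, hz⟩
  suffices ∃ s ∈ q.asIdeal.primeCompl, s • z = 0 from
    this.imp fun s hs ↦ ⟨hs.1, Subtype.ext hs.2⟩
  have hvan (j : ℕ) : IsLocCohTorsion I q.asIdeal.primeCompl j T.X₃ := by
    cases j with
    | zero =>
      obtain ⟨E', f', _, _, hE'⟩ := exists_injective_powTorsion_eq_bot I
        (↥(Limits.cokernel f) ⧸ powTorsion I ↥(Limits.cokernel f)) powTorsion_quotient
      exact IsLocCohTorsion.of_mono (X := T.X₃) f' (isLocCohTorsion_of_powTorsion_eq_bot _ hE' 0)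
    | succ j =>
      exact ((isLocCohTorsion_of_powTorsion_eq_bot _ hE (j + 1)).of_X₂_X₁ hD
        (h q hq j).quotient_powTorsion).quotient_powTorsion
  cases i with
  | zero =>
    have := hT.mono_f
    exact ⟨1, Submonoid.one_mem _, by
      rw [Abelian.Ext.postcomp_mk₀_injective_of_mono N T.f (hz.trans (map_zero _).symm),
        smul_zero]⟩
  | succ i =>
    obtain ⟨w, hw⟩ := Abelian.Ext.covariant_sequence_exact₁ N hT z hz rfl
    obtain ⟨s, hs, e⟩ := exists_smul_ext_eq_zero_of_isLocCohTorsion N hN i _ (fun j _ ↦ hvan j) w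
    exact ⟨s, hs, by rw [← hw, ← Abelian.Ext.smul_comp, e, Abelian.Ext.zero_comp]⟩

lemma associatedPrimes_ext_localCohomology_finite [IsLocalRing R] (N X : ModuleCat.{u} R)
    [Module.Finite R N] [Module.Finite R X] (hX : Module.supportDim R X ≤ 3)
    (hN : Module.support R N ⊆ PrimeSpectrum.zeroLocus (I : Set R)) (i j : ℕ) :
    (associatedPrimes R (Abelian.Ext N ((localCohomology I j).obj X) i)).Finite := by
  obtain ⟨k, hk⟩ := exists_pow_smul_eq_zero_of_support_subset hN
  obtain ⟨W, hW, h⟩ : ∃ W : Set (PrimeSpectrum R), W.Finite ∧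
      ∀ q ∉ W, ∀ j, IsLocCohTorsion I q.asIdeal.primeCompl (j + 2) X := by
    by_cases hI : I = ⊤
    · exact ⟨∅, Set.finite_empty, fun q _ j ↦
        isLocCohTorsion_of_mem X (Submonoid.one_mem _) (hI ▸ Submodule.mem_top)⟩
    · exact exists_finite_isLocCohTorsion hI X hX
  match j with
  | 0 =>
    have := finite_localCohomology_zero (I := I) X
    have := ModuleCat.finite_ext R N ((localCohomology I 0).obj X) i
    exact associatedPrimes.finite R _
  | 1 => exact associatedPrimes_ext_localCohomology_one_finite N X hk hW h i
  | j + 2 =>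
    exact associatedPrimes_finite_of_exists_smul_eq_zero hW fun q hq z ↦
      exists_smul_ext_eq_zero N _ (h q hq j).exists_smul_localCohomology_eq_zero i z

lemma associatedPrimes_subset_associatedPrimes_ext_zero {A : ModuleCat.{u} R}
    (hA : powTorsion I A = ⊤) :
    associatedPrimes R A ⊆ associatedPrimes R (Abelian.Ext (ModuleCat.of R (R ⧸ I)) A 0) := by
  intro p hp
  obtain ⟨hp, x, hx⟩ := isAssociatedPrime_iff.1 hp
  have hmem (r : R) : r ∈ p ↔ r • x = 0 := by
    rw [hx, Submodule.mem_colon_singleton, Submodule.mem_bot]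
  obtain ⟨n, hn⟩ : x ∈ powTorsion I A := hA ▸ Submodule.mem_top
  have hIp : I ≤ p := Ideal.IsPrime.le_of_pow_le fun r hr ↦ (hmem r).2 (hn r hr)
  let f : ModuleCat.of R (R ⧸ I) ⟶ A := ModuleCat.ofHom
    (Submodule.liftQ I (LinearMap.toSpanSingleton R A x) fun r hr ↦ (hmem r).1 (hIp hr))
  refine isAssociatedPrime_iff.2 ⟨hp, Abelian.Ext.mk₀ f, ?_⟩
  ext r
  rw [hmem, Submodule.mem_colon_singleton, Submodule.mem_bot, ← Abelian.Ext.mk₀_smul,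
    Abelian.Ext.mk₀_eq_zero_iff]
  constructor
  · intro h
    apply ModuleCat.hom_ext
    refine Submodule.linearMap_qext _ (LinearMap.ext_ring ?_)
    change r • (1 : R) • x = 0
    rw [one_smul, h]
  · intro h
    have h1 : r • (1 : R) • x = 0 := congrArg (fun f ↦ f.hom (Submodule.Quotient.mk 1)) h
    rwa [one_smul] at h1

end FiniteAssociatedPrimes

theorem stmt19 (R : Type u) [CommRing R] [IsNoetherianRing R] [IsLocalRing R]
    (I : Ideal R) (M : Type u) [AddCommGroup M] [Module R M] [Module.Finite R M]
    (h3 : moduleDim R M ≤ 3)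
    (N : Type u) [AddCommGroup N] [Module R N] [Module.Finite R N]
    (hN : Module.support R N ⊆ PrimeSpectrum.zeroLocus (I : Set R)) :
    (∀ i j : ℕ,
      (associatedPrimes R
        ↥(((Ext R (ModuleCat.{u} R) i).obj (Opposite.op (ModuleCat.of R N))).obj
          ((localCohomology I j).obj (ModuleCat.of R M)))).Finite) ∧
    ∀ j : ℕ, (associatedPrimes R ↥((localCohomology I j).obj (ModuleCat.of R M))).Finite := by
  have hM : Module.supportDim R (ModuleCat.of R M) ≤ 3 :=
    (Module.supportDim_eq_ringKrullDim_quotient_annihilator R M).trans_le h3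
  refine ⟨fun i j ↦ ?_, fun j ↦ ?_⟩
  · rw [LinearEquiv.AssociatedPrimes.eq (extEquiv _ _ i)]
    exact associatedPrimes_ext_localCohomology_finite (ModuleCat.of R N) (ModuleCat.of R M)
      hM hN i j
  · have hfin : Module.Finite R (ModuleCat.of R (R ⧸ I)) :=
      inferInstanceAs (Module.Finite R (R ⧸ I))
    have hI : Module.support R (R ⧸ I) ⊆ PrimeSpectrum.zeroLocus (I : Set R) := by
      rw [Module.support_eq_zeroLocus, Ideal.annihilator_quotient]
    exact (associatedPrimes_ext_localCohomology_finite (ModuleCat.of R (R ⧸ I))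
      (ModuleCat.of R M) hM hI 0 j).subset (associatedPrimes_subset_associatedPrimes_ext_zero
        (eq_top_iff.2 fun y _ ↦ exists_pow_smul_localCohomology_eq_zero y))
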